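/- arXiv:2101.01698 — 5 statements merged into one kernel-verified Lean document; each statement's English description precedes it below -/
import Mathlib

section
/- Let C be a type, let Γ : Set C → Set C be monotone (A ⊆ B implies Γ A ⊆ Γ B), and let K : Set C be a prefixpoint of Γ, i.e. Γ K ⊆ K. Let X : Ordinal → Set C be the inductive chain of Γ, i.e. X α = ⋃ β < α, Γ (X β) for every ordinal α. Then Γ inductively stabilizes below the successor cardinal of K: there exists an ordinal α < (Order.succ #↥K).ord such that Γ (X α) ⊆ X α. -/
theorem inductive_chain_stabilizes_of_prefixpoint
    (C : Type u) (Γ : Set C → Set C) (hmono : ∀ A B : Set C, A ⊆ B → Γ A ⊆ Γ B)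
    (K : Set C) (hK : Γ K ⊆ K)
    (X : Ordinal.{u} → Set C)
    (hX : ∀ α : Ordinal.{u}, X α = ⋃ β < α, Γ (X β)) :
    ∃ α : Ordinal.{u}, α < (Order.succ (Cardinal.mk ↥K)).ord ∧ Γ (X α) ⊆ X α := by
  by_contra! h
  have hXK : ∀ α, Γ (X α) ⊆ K := by
    intro α
    induction α using WellFoundedLT.induction with
    | ind α ih =>
      refine (hmono _ _ ?_).trans hK
      rw [hX α]
      exact Set.iUnion₂_subset ih
  have hstep : ∀ α β, α < β → Γ (X α) ⊆ X β := by
    intro α β hαβ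
    rw [hX β]
    exact Set.subset_biUnion_of_mem (u := fun γ => Γ (X γ)) hαβ
  have hnew : ∀ α < (Order.succ (Cardinal.mk ↥K)).ord,
      ∃ x : K, (x : C) ∈ Γ (X α) ∧ (x : C) ∉ X α := by
    intro α hα
    obtain ⟨x, hx, hx'⟩ := Set.not_subset.1 (h α hα)
    exact ⟨⟨x, hXK α hx⟩, hx, hx'⟩
  have hpos : 0 < (Order.succ (Cardinal.mk ↥K)).ord := by
    rw [Cardinal.lt_ord, Ordinal.card_zero]
    exact Order.bot_lt_succ _
  have : Nonempty K := (hnew 0 hpos).nonempty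
  choose! f hf hf' using hnew
  refine Cardinal.not_injective_limitation_set f ?_
  intro α hα β hβ hαβ
  rcases lt_trichotomy α β with hlt | heq | hlt
  · exact absurd (hαβ ▸ hstep α β hlt (hf α hα)) (hf' β hβ)
  · exact heq
  · exact absurd (hαβ ▸ hstep β α hlt (hf β hβ)) (hf' α hα)
end

section
/- Broad Infinity is equivalent to Reduced Broad Infinity: every broad signature (I, K) has a least (I,K)-inductive set if and only if every reduced broad signature F : ZFSet → ZFSet has a least F-inductive set. -/
universe u

/-- A set `X` is `F`-inductive for a reduced broad signature `F : ZFSet → ZFSet`. -/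
def RBInductive (F : ZFSet.{u} → ZFSet.{u}) (X : ZFSet.{u}) : Prop :=
  ∅ ∈ X ∧ ∀ x ∈ X, ∀ f ∈ ZFSet.funs (F x) X, ZFSet.pair x f ∈ X

/-- A set `X` is `(I,K)`-inductive for a broad signature given by index sets `I` and
arities `K`. -/
def BInductive (I : ZFSet.{u} → ZFSet.{u}) (K : ZFSet.{u} → ZFSet.{u} → ZFSet.{u})
    (X : ZFSet.{u}) : Prop :=
  ∅ ∈ X ∧ ∀ x ∈ X, ∀ i ∈ I x, ∀ f ∈ ZFSet.funs (K x i) X,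
    ZFSet.pair x (ZFSet.pair i f) ∈ X

open Order in
theorem ZFSet.rank_kuratowskiPair (x y : ZFSet.{u}) :
    (ZFSet.pair x y).rank = succ (succ (max x.rank y.rank)) := by
  rw [ZFSet.pair, ZFSet.rank_pair, ZFSet.rank_pair, ZFSet.rank_singleton, succ_mono.map_max,
    succ_mono.map_max, succ_mono.map_max, ← max_assoc, max_self]

theorem ZFSet.IsFunc.mono_right {a b c f : ZFSet.{u}} (hf : ZFSet.IsFunc a b f) (h : b ⊆ c) :
    ZFSet.IsFunc a c f := by
  refine ⟨fun p hp ↦ ?_, hf.2⟩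
  obtain ⟨x, hx, y, hy, rfl⟩ := ZFSet.mem_prod.1 (hf.1 hp)
  exact ZFSet.pair_mem_prod.2 ⟨hx, h hy⟩

theorem RBInductive.exists_least {F : ZFSet.{u} → ZFSet.{u}} {Y : ZFSet.{u}}
    (hY : RBInductive F Y) :
    ∃ X : ZFSet.{u}, RBInductive F X ∧ ∀ Z : ZFSet.{u}, RBInductive F Z → X ⊆ Z := by
  set X := ZFSet.sep (fun x ↦ ∀ Z, RBInductive F Z → x ∈ Z) Y
  have hX : ∀ Z, RBInductive F Z → X ⊆ Z := fun Z hZ x hx ↦ (ZFSet.mem_sep.1 hx).2 Z hZ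
  have key : ∀ x, (∀ Z, RBInductive F Z → x ∈ Z) → x ∈ X := fun x h ↦
    ZFSet.mem_sep.2 ⟨h Y hY, h⟩
  refine ⟨X, ⟨key _ fun Z hZ ↦ hZ.1, fun x hx f hf ↦ key _ fun Z hZ ↦ ?_⟩, hX⟩
  exact hZ.2 x (hX Z hZ hx) f (ZFSet.mem_funs.2 ((ZFSet.mem_funs.1 hf).mono_right (hX Z hZ)))

theorem BInductive.exists_least {I : ZFSet.{u} → ZFSet.{u}} {K : ZFSet.{u} → ZFSet.{u} → ZFSet.{u}}
    {Y : ZFSet.{u}} (hY : BInductive I K Y) :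
    ∃ X : ZFSet.{u}, BInductive I K X ∧ ∀ Z : ZFSet.{u}, BInductive I K Z → X ⊆ Z := by
  set X := ZFSet.sep (fun x ↦ ∀ Z, BInductive I K Z → x ∈ Z) Y
  have hX : ∀ Z, BInductive I K Z → X ⊆ Z := fun Z hZ x hx ↦ (ZFSet.mem_sep.1 hx).2 Z hZ
  have key : ∀ x, (∀ Z, BInductive I K Z → x ∈ Z) → x ∈ X := fun x h ↦
    ZFSet.mem_sep.2 ⟨h Y hY, h⟩
  refine ⟨X, ⟨key _ fun Z hZ ↦ hZ.1, fun x hx i hi f hf ↦ key _ fun Z hZ ↦ ?_⟩, hX⟩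
  exact hZ.2 x (hX Z hZ hx) i hi f
    (ZFSet.mem_funs.2 ((ZFSet.mem_funs.1 hf).mono_right (hX Z hZ)))

/-- `X` contains `∅`, and for every `x ∈ X` and every `f : F x → X` it has an element of rank
greater than the ranks of `x` and `f`. -/
def RankInductive (F : ZFSet.{u} → ZFSet.{u}) (X : ZFSet.{u}) : Prop :=
  ∅ ∈ X ∧ ∀ x ∈ X, ∀ f ∈ ZFSet.funs (F x) X, ∃ y ∈ X, x.rank < y.rank ∧ f.rank < y.rank

theorem ZFSet.rank_lt_rank_pair_left (x y : ZFSet.{u}) : x.rank < (ZFSet.pair x y).rank := by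
  rw [ZFSet.rank_kuratowskiPair]
  exact (le_max_left _ _).trans_lt ((Order.lt_succ _).trans (Order.lt_succ _))

theorem ZFSet.rank_lt_rank_pair_right (x y : ZFSet.{u}) : y.rank < (ZFSet.pair x y).rank := by
  rw [ZFSet.rank_kuratowskiPair]
  exact (le_max_right _ _).trans_lt ((Order.lt_succ _).trans (Order.lt_succ _))

theorem RBInductive.rankInductive {F : ZFSet.{u} → ZFSet.{u}} {X : ZFSet.{u}}
    (hX : RBInductive F X) : RankInductive F X :=
  ⟨hX.1, fun x hx f hf ↦ ⟨_, hX.2 x hx f hf, ZFSet.rank_lt_rank_pair_left _ _,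
    ZFSet.rank_lt_rank_pair_right _ _⟩⟩

theorem BInductive.rankInductive {F : ZFSet.{u} → ZFSet.{u}} {X : ZFSet.{u}}
    (hX : BInductive (fun _ ↦ {∅}) (fun x _ ↦ F x) X) : RankInductive F X :=
  ⟨hX.1, fun x hx f hf ↦ ⟨_, hX.2 x hx ∅ (ZFSet.mem_singleton.2 rfl) f hf,
    ZFSet.rank_lt_rank_pair_left _ _,
    (ZFSet.rank_lt_rank_pair_right _ _).trans (ZFSet.rank_lt_rank_pair_right _ _)⟩⟩

/-- `Y` is closed under pairing, contains all elements of `G x` for `x ∈ Y`, and contains all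
functions into `Y` whose domain is a subset of some such `G x`. -/
structure FunctionClosed (G : ZFSet.{u} → ZFSet.{u}) (Y : ZFSet.{u}) : Prop where
  empty_mem : ∅ ∈ Y
  pair_mem : ∀ x ∈ Y, ∀ y ∈ Y, ZFSet.pair x y ∈ Y
  subset : ∀ x ∈ Y, G x ⊆ Y
  funs_subset : ∀ x ∈ Y, ∀ a ⊆ G x, ZFSet.funs a Y ⊆ Y

/-- The union of all `G y` with `y` of rank at most that of `x`. -/
noncomputable def rankUnion (G : ZFSet.{u} → ZFSet.{u}) (x : ZFSet.{u}) : ZFSet.{u} :=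
  ZFSet.iUnion fun y : ZFSet.vonNeumann (Order.succ x.rank) ↦ G y

theorem subset_rankUnion {G : ZFSet.{u} → ZFSet.{u}} {x y : ZFSet.{u}} (h : y.rank ≤ x.rank) :
    G y ⊆ rankUnion G x :=
  ZFSet.subset_iUnion (fun y : ZFSet.vonNeumann (Order.succ x.rank) ↦ G y)
    ⟨y, ZFSet.mem_vonNeumann.2 (Order.lt_succ_of_le h)⟩

theorem RankInductive.functionClosed {G : ZFSet.{u} → ZFSet.{u}} {X : ZFSet.{u}}
    (hX : RankInductive (rankUnion G) X) :
    FunctionClosed G (ZFSet.vonNeumann X.rank) := by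
  have graph : ∀ c ∈ X, ∀ h : ZFSet.{u} → ZFSet.{u}, (∀ z, h z ∈ X) →
      ∃ d ∈ X, c.rank < d.rank ∧
        ∃ r < d.rank, ∀ z ∈ rankUnion G c, (ZFSet.pair z (h z)).rank < r := by
    intro c hc h hh
    let _ : ZFSet.Definable₁ h := Classical.allZFSetDefinable _
    obtain ⟨d, hd, hcd, hfd⟩ :=
      hX.2 c hc (ZFSet.map h (rankUnion G c)) (ZFSet.mem_funs.2 (ZFSet.map_isFunc.2 fun z _ ↦ hh z))
    exact ⟨d, hd, hcd, _, hfd, fun z hz ↦ ZFSet.rank_lt_of_mem (ZFSet.mem_map.2 ⟨z, hz, rfl⟩)⟩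
  have succ_lt : ∀ o < X.rank, Order.succ o < X.rank := by
    intro o ho
    obtain ⟨c, hc, hoc⟩ := ZFSet.lt_rank_iff.1 ho
    obtain ⟨d, hd, hcd, -⟩ := graph c hc (fun _ ↦ ∅) fun _ ↦ hX.1
    exact (Order.succ_le_of_lt (hoc.trans_lt hcd)).trans_lt (ZFSet.rank_lt_of_mem hd)
  refine ⟨?_, ?_, ?_, ?_⟩
  · exact ZFSet.mem_vonNeumann.2 (ZFSet.rank_lt_of_mem hX.1)
  · intro x hx y hy
    rw [ZFSet.mem_vonNeumann] at hx hy ⊢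
    rw [ZFSet.rank_kuratowskiPair]
    exact succ_lt _ (succ_lt _ (max_lt hx hy))
  · intro x hx z hz
    rw [ZFSet.mem_vonNeumann] at hx ⊢
    obtain ⟨c, hc, hxc⟩ := ZFSet.lt_rank_iff.1 hx
    obtain ⟨d, hd, -, r, hrd, hr⟩ := graph c hc (fun _ ↦ ∅) fun _ ↦ hX.1
    exact (ZFSet.rank_lt_rank_pair_left z ∅).trans <| (hr z (subset_rankUnion hxc hz)).trans <|
      hrd.trans (ZFSet.rank_lt_of_mem hd)
  · intro x hx a ha f hf
    rw [ZFSet.mem_vonNeumann] at hx ⊢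
    rw [ZFSet.mem_funs] at hf
    obtain ⟨c, hc, hxc⟩ := ZFSet.lt_rank_iff.1 hx
    have bound : ∀ z, ∃ y ∈ X, ∀ w, ZFSet.pair z w ∈ f → w.rank ≤ y.rank := by
      intro z
      by_cases hz : ∃ w, ZFSet.pair z w ∈ f
      · obtain ⟨w, hw⟩ := hz
        obtain ⟨hza, hwY⟩ := ZFSet.pair_mem_prod.1 (hf.1 hw)
        obtain ⟨y, hy, hwy⟩ := ZFSet.lt_rank_iff.1 (ZFSet.mem_vonNeumann.1 hwY)
        exact ⟨y, hy, fun v hv ↦ (hf.2 z hza).unique hw hv ▸ hwy⟩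
      · exact ⟨∅, hX.1, fun w hw ↦ (hz ⟨w, hw⟩).elim⟩
    choose h hh hle using bound
    obtain ⟨d, hd, -, r, hrd, hr⟩ := graph c hc h hh
    refine lt_of_le_of_lt ?_ (hrd.trans (ZFSet.rank_lt_of_mem hd))
    rw [ZFSet.rank_le_iff]
    intro p hp
    obtain ⟨z, hz, w, -, rfl⟩ := ZFSet.mem_prod.1 (hf.1 hp)
    refine lt_of_le_of_lt ?_ (hr z (subset_rankUnion hxc (ha hz)))
    rw [ZFSet.rank_kuratowskiPair, ZFSet.rank_kuratowskiPair]
    exact Order.succ_le_succ (Order.succ_le_succ (max_le_max le_rfl (hle z w hp)))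

theorem FunctionClosed.rbInductive {F : ZFSet.{u} → ZFSet.{u}} {Y : ZFSet.{u}}
    (hY : FunctionClosed F Y) : RBInductive F Y :=
  ⟨hY.empty_mem, fun x hx f hf ↦
    hY.pair_mem x hx f (hY.funs_subset x hx (F x) (fun _ h ↦ h) hf)⟩

theorem FunctionClosed.bInductive {I : ZFSet.{u} → ZFSet.{u}}
    {K : ZFSet.{u} → ZFSet.{u} → ZFSet.{u}} {Y : ZFSet.{u}}
    (hY : FunctionClosed
      (fun x ↦ I x ∪ ZFSet.iUnion fun i : I x ↦ K x i) Y) :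
    BInductive I K Y := by
  refine ⟨hY.empty_mem, fun x hx i hi f hf ↦ hY.pair_mem x hx _ (hY.pair_mem i ?_ f ?_)⟩
  · exact hY.subset x hx (ZFSet.mem_union.2 (Or.inl hi))
  · exact hY.funs_subset x hx (K x i)
      (fun z hz ↦ ZFSet.mem_union.2 (Or.inr (ZFSet.mem_iUnion.2 ⟨⟨i, hi⟩, hz⟩))) hf

theorem broad_infinity_iff_reduced_broad_infinity :
    (∀ (I : ZFSet.{u} → ZFSet.{u}) (K : ZFSet.{u} → ZFSet.{u} → ZFSet.{u}),
      ∃ X : ZFSet.{u}, BInductive I K X ∧ ∀ Y : ZFSet.{u}, BInductive I K Y → X ⊆ Y) ↔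
    (∀ F : ZFSet.{u} → ZFSet.{u},
      ∃ X : ZFSet.{u}, RBInductive F X ∧ ∀ Y : ZFSet.{u}, RBInductive F Y → X ⊆ Y) := by
  constructor
  · intro h F
    obtain ⟨X, hX, -⟩ := h (fun _ ↦ {∅}) fun x _ ↦ rankUnion F x
    exact hX.rankInductive.functionClosed.rbInductive.exists_least
  · intro h I K
    obtain ⟨X, hX, -⟩ :=
      h (rankUnion fun x ↦ I x ∪ ZFSet.iUnion fun i : I x ↦ K x i)
    exact hX.rankInductive.functionClosed.bInductive.exists_least
end

section
/- Signature Infinity holds in ZFSet: for every I : ZFSet and every K : ZFSet → ZFSet there exists a least S-inductive set, i.e. an X : ZFSet that is S-inductive and satisfies X ⊆ Y for every S-inductive Y : ZFSet. -/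
universe u

/-- A set `X` is `S`-inductive for the signature with symbols `I` and arities `K`. -/
def SInductive (I : ZFSet.{u}) (K : ZFSet.{u} → ZFSet.{u}) (X : ZFSet.{u}) : Prop :=
  ∀ i ∈ I, ∀ f ∈ ZFSet.funs (K i) X, ZFSet.pair i f ∈ X

namespace ZFSet

/-- The set-coded function on `x` given by a family of sets indexed by the elements of `x`. -/
noncomputable def graph {x : ZFSet.{u}} (g : Shrink.{u} x → ZFSet.{u}) : ZFSet.{u} :=
  range fun b => pair ((equivShrink x).symm b : ZFSet.{u}) (g b)

theorem graph_mem_funs {x y : ZFSet.{u}} {g : Shrink.{u} x → ZFSet.{u}} (hg : ∀ b, g b ∈ y) :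
    graph g ∈ funs x y := by
  refine mem_funs.2 ⟨fun p hp => ?_, fun z hz => ⟨g (equivShrink x ⟨z, hz⟩), ?_, fun w hw => ?_⟩⟩
  · obtain ⟨b, rfl⟩ := mem_range.1 hp
    exact pair_mem_prod.2 ⟨((equivShrink x).symm b).2, hg b⟩
  · exact mem_range.2 ⟨equivShrink x ⟨z, hz⟩, by simp⟩
  · obtain ⟨b, hb⟩ := mem_range.1 hw
    obtain ⟨rfl, rfl⟩ := pair_inj.1 hb
    simp

theorem exists_graph_eq_of_mem_funs {x y f : ZFSet.{u}} (hf : f ∈ funs x y) :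
    ∃ g : Shrink.{u} x → ZFSet.{u}, (∀ b, g b ∈ y) ∧ graph g = f := by
  obtain ⟨hsub, huniq⟩ := mem_funs.1 hf
  choose g hg hg_uniq using fun b : Shrink.{u} x =>
    huniq ((equivShrink x).symm b) ((equivShrink x).symm b).2
  refine ⟨g, fun b => (pair_mem_prod.1 (hsub (hg b))).2,
    ZFSet.ext fun p => ⟨fun hp => ?_, fun hp => ?_⟩⟩
  · obtain ⟨b, rfl⟩ := mem_range.1 hp
    exact hg b
  · obtain ⟨z, hz, w, -, rfl⟩ := mem_prod.1 (hsub hp)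
    refine mem_range.2 ⟨equivShrink x ⟨z, hz⟩, ?_⟩
    rw [← hg_uniq (equivShrink x ⟨z, hz⟩) w (by simpa using hp)]
    simp

/-- The set coded by a well-founded tree whose nodes are labelled by symbols in `I` and whose
branching is given by the arities `K`. -/
noncomputable def ofWType (I : ZFSet.{u}) (K : ZFSet.{u} → ZFSet.{u}) :
    WType (fun a : Shrink.{u} I => Shrink.{u} (K ((equivShrink I).symm a))) → ZFSet.{u}
  | ⟨a, t⟩ => pair ((equivShrink I).symm a : ZFSet.{u}) (graph fun b => ofWType I K (t b))

end ZFSet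

theorem SInductive.range_ofWType (I : ZFSet.{u}) (K : ZFSet.{u} → ZFSet.{u}) :
    SInductive I K (ZFSet.range (ZFSet.ofWType I K)) := by
  intro i hi f hf
  obtain ⟨a, ha⟩ := (equivShrink I).symm.surjective ⟨i, hi⟩
  obtain rfl : ((equivShrink I).symm a : ZFSet.{u}) = i := congrArg Subtype.val ha
  obtain ⟨g, hg, rfl⟩ := ZFSet.exists_graph_eq_of_mem_funs hf
  choose t ht using fun b => ZFSet.mem_range.1 (hg b)
  exact ZFSet.mem_range.2 ⟨⟨a, t⟩, by simp only [ZFSet.ofWType, ht]⟩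

theorem SInductive.ofWType_mem {I : ZFSet.{u}} {K : ZFSet.{u} → ZFSet.{u}} {Y : ZFSet.{u}}
    (hY : SInductive I K Y) (w) : ZFSet.ofWType I K w ∈ Y := by
  induction w with
  | mk a t ih =>
    rw [ZFSet.ofWType]
    exact hY _ ((equivShrink I).symm a).2 _ (ZFSet.graph_mem_funs ih)

theorem signature_infinity (I : ZFSet.{u}) (K : ZFSet.{u} → ZFSet.{u}) :
    ∃ X : ZFSet.{u}, SInductive I K X ∧ ∀ Y : ZFSet.{u}, SInductive I K Y → X ⊆ Y := by
  refine ⟨ZFSet.range (ZFSet.ofWType I K), SInductive.range_ofWType I K, fun Y hY x hx => ?_⟩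
  obtain ⟨w, rfl⟩ := ZFSet.mem_range.1 hx
  exact hY.ofWType_mem w
end

section
/- Fix types I : Type u and β : I → Type u. For any s t : WType β, if for every list ℓ : List (Σ i, β i) and all r r' : I with Br s ℓ r and Br t ℓ r' we have r = r', then s = t. (An S-term is determined by the map from its branches to their results.) -/
universe u

/-- `Br t ℓ r` says that `ℓ` is a branch of the term `t : WType β` with result `r`. -/
inductive Br {I : Type u} {β : I → Type u} : WType β → List (Σ i, β i) → I → Prop
  | nil (i : I) (f : β i → WType β) : Br (WType.mk i f) [] i
  | cons (i : I) (f : β i → WType β) (k : β i) (ℓ : List (Σ i, β i)) (r : I) :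
      Br (f k) ℓ r → Br (WType.mk i f) (⟨i, k⟩ :: ℓ) r

theorem wtype_determined_by_branches {I : Type u} {β : I → Type u}
    (s t : WType β)
    (h : ∀ (ℓ : List (Σ i, β i)) (r r' : I), Br s ℓ r → Br t ℓ r' → r = r') :
    s = t := by
  induction s generalizing t with
  | mk i f ih =>
    obtain ⟨j, g⟩ := t
    obtain rfl : i = j := h [] i j (Br.nil i f) (Br.nil j g)
    congr 1
    funext k
    exact ih k (g k) fun ℓ r r' hr hr' =>
      h (⟨i, k⟩ :: ℓ) r r' (Br.cons i f k ℓ r hr) (Br.cons i g k ℓ r' hr')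
end

section
/- Let T : Type u, M : Set T, J : T → Set T, and suppose E : Set T is the least inductive set: E is inductive and E ⊆ X for every inductive X : Set T. Let C : T → Type u and let H : (x : T) → ((y : {y : T // y ∈ J x}) → C y.1) → C x. Then there exists a unique function F : (x : {x : T // x ∈ E}) → C x.1 such that for every x : T and every hx : x ∈ E, F ⟨x, hx⟩ = H x (fun y => F ⟨y.1, hy⟩), where hy is the proof that y.1 ∈ E (which exists because the least inductive set E is a fixpoint: every x ∈ E satisfies x ∈ M and J x ⊆ E). -/
universe u

/-- `X` is inductive for the spection given by `M` and `J`. -/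
def SpInductive {T : Type u} (M : Set T) (J : T → Set T) (X : Set T) : Prop :=
  ∀ e ∈ M, J e ⊆ X → e ∈ X

theorem SpInductive.subset_of_mem_least {T : Type u} {M : Set T} {J : T → Set T} {E : Set T}
    (hind : SpInductive M J E) (hleast : ∀ X : Set T, SpInductive M J X → E ⊆ X)
    {x : T} (hx : x ∈ E) : J x ⊆ E :=
  (hleast {x | x ∈ E ∧ J x ⊆ E}
    (fun e he hJ => ⟨hind e he fun _ hy => (hJ hy).1, fun _ hy => (hJ hy).1⟩) hx).2

theorem SpInductive.acc_of_mem_least {T : Type u} {M : Set T} {J : T → Set T} {E : Set T}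
    (hleast : ∀ X : Set T, SpInductive M J X → E ⊆ X)
    {x : T} (hx : x ∈ E) : Acc (fun y x => y ∈ J x) x :=
  hleast {x | Acc (fun y x => y ∈ J x) x} (fun e _ hJ => Acc.intro e fun _ hy => hJ hy) hx

theorem recursion_over_generated_class
    {T : Type u} (M : Set T) (J : T → Set T) (E : Set T)
    (hind : SpInductive M J E)
    (hleast : ∀ X : Set T, SpInductive M J X → E ⊆ X)
    (C : T → Type u)
    (H : (x : T) → ((y : {y : T // y ∈ J x}) → C y.1) → C x) :
    ∃! F : (x : {x : T // x ∈ E}) → C x.1,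
      ∀ (x : T) (hx : x ∈ E) (hJ : J x ⊆ E),
        F ⟨x, hx⟩ = H x (fun y => F ⟨y.1, hJ y.2⟩) := by
  have hacc : ∀ x ∈ E, Acc (fun y x => y ∈ J x) x :=
    fun _ hx => SpInductive.acc_of_mem_least hleast hx
  let G : (x : T) → Acc (fun y x => y ∈ J x) x → C x := fun _ h =>
    Acc.rec (motive := fun x _ => C x) (fun x _ ih => H x fun y => ih y.1 y.2) h
  refine ⟨fun x => G x.1 (hacc x.1 x.2), fun x hx hJ => ?_, fun F hF => ?_⟩
  · have hG : ∀ h : Acc (fun y x => y ∈ J x) x,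
        G x h = H x fun y => G y.1 (h.inv y.2) := by
      rintro ⟨_, h⟩
      rfl
    exact hG _
  · have hFG : ∀ (x : T) (h : Acc (fun y x => y ∈ J x) x) (hx : x ∈ E), F ⟨x, hx⟩ = G x h := by
      intro x h
      induction h with
      | intro x h ih =>
        intro hx
        have hJ := hind.subset_of_mem_least hleast hx
        rw [hF x hx hJ]
        exact congrArg (H x) (funext fun y => ih y.1 y.2 (hJ y.2))
    exact funext fun x => hFG x.1 _ x.2
end
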